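/- Let G be a non-elementary word-hyperbolic group with a finite generating set X. Then there exist real constants λ > 1 and D > 1 such that for all integers n ≥ 0, D⁻¹·λⁿ ≤ 𝔅(n) ≤ D·λⁿ, where 𝔅(n) is the cardinality of the ball of radius n in G with respect to X. -/

import Mathlib

/-!
Coornaert's theorem: a non-elementary word-hyperbolic group has purely
exponential growth of balls.
-/

/-- The word length of `g` with respect to a generating set `X`: the least `n` such that
`g` is a product of `n` elements of `X ∪ X⁻¹`. -/
noncomputable def wordLength {G : Type*} [Group G] (X : Set G) (g : G) : ℕ :=
  sInf {n | ∃ w : List G, w.length = n ∧ (∀ x ∈ w, x ∈ X ∨ x⁻¹ ∈ X) ∧ w.prod = g}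

/-- The word metric `d(g,h) = |g⁻¹h|_X`. -/
noncomputable def wordDist {G : Type*} [Group G] (X : Set G) (g h : G) : ℕ :=
  wordLength X (g⁻¹ * h)

/-- `𝔖(n)`, the cardinality of the sphere of radius `n`. -/
noncomputable def sphereCard {G : Type*} [Group G] (X : Set G) (n : ℕ) : ℕ :=
  {g : G | wordLength X g = n}.ncard

/-- `𝔅(n)`, the cardinality of the ball of radius `n`. -/
noncomputable def ballCard {G : Type*} [Group G] (X : Set G) (n : ℕ) : ℕ :=
  {g : G | wordLength X g ≤ n}.ncard

/-- A (discrete) geodesic in the Cayley graph `Γ(G,X)` from `a` to `b`: the sequence of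
vertices visited by a geodesic path, parametrised by arc length. -/
def IsGeodesic {G : Type*} [Group G] (X : Set G) (a b : G) (γ : ℕ → G) : Prop :=
  γ 0 = a ∧ γ (wordDist X a b) = b ∧
    ∀ i j, i ≤ wordDist X a b → j ≤ wordDist X a b →
      wordDist X (γ i) (γ j) = Nat.dist i j

/-- Triangles in the Cayley graph `Γ(G,X)` are `δ`-thin (`δ` a positive integer): every
vertex on one side of a geodesic triangle is at distance at most `δ` from the union of the
other two sides. -/
def TrianglesThin {G : Type*} [Group G] (X : Set G) (δ : ℕ) : Prop :=
  ∀ (a b c : G) (γ₁ γ₂ γ₃ : ℕ → G),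
    IsGeodesic X a b γ₁ → IsGeodesic X b c γ₂ → IsGeodesic X a c γ₃ →
    ∀ i ≤ wordDist X a c, ∃ j,
      (j ≤ wordDist X a b ∧ wordDist X (γ₃ i) (γ₁ j) ≤ δ) ∨
      (j ≤ wordDist X b c ∧ wordDist X (γ₃ i) (γ₂ j) ≤ δ)

/-- A group is virtually cyclic if it has a cyclic subgroup of finite index. -/
def VirtuallyCyclic (G : Type*) [Group G] : Prop :=
  ∃ H : Subgroup G, IsCyclic H ∧ H.FiniteIndex

/-- An integer-valued length function on a group whose balls are finite, whose metric is discretely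
geodesic, and which satisfies Gromov's four-point condition with constant `E`. -/
structure IsHyperbolicLength {G : Type*} [Group G] (L : G → ℕ) (E : ℕ) : Prop where
  one : L 1 = 0
  inv : ∀ g, L g⁻¹ = L g
  mul_le : ∀ g h, L (g * h) ≤ L g + L h
  four_point : ∀ x y z w : G,
    L (x⁻¹ * z) + L (y⁻¹ * w) ≤ L (x⁻¹ * y) + L (z⁻¹ * w) + E ∨
      L (x⁻¹ * z) + L (y⁻¹ * w) ≤ L (x⁻¹ * w) + L (y⁻¹ * z) + E
  finite_ball : ∀ n, {g | L g ≤ n}.Finite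
  exists_split : ∀ g i, i ≤ L g → ∃ a b, a * b = g ∧ L a = i ∧ L b + i = L g

section WordLength

variable {G : Type*} [Group G] {X : Set G}

theorem exists_word_of_closure_eq_top (hgen : Subgroup.closure X = ⊤) (g : G) :
    ∃ w : List G, w.length = wordLength X g ∧ (∀ x ∈ w, x ∈ X ∨ x⁻¹ ∈ X) ∧ w.prod = g := by
  have hne : {n | ∃ w : List G, w.length = n ∧ (∀ x ∈ w, x ∈ X ∨ x⁻¹ ∈ X) ∧
      w.prod = g}.Nonempty := by
    have hg : g ∈ (Subgroup.closure X).toSubmonoid := by rw [hgen]; trivial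
    rw [Subgroup.closure_toSubmonoid] at hg
    obtain ⟨l, hl, hp⟩ := Submonoid.exists_list_of_mem_closure hg
    exact ⟨l.length, l, rfl, fun x hx => by simpa using hl x hx, hp⟩
  exact Nat.sInf_mem hne

theorem wordLength_prod_le {w : List G} (hw : ∀ x ∈ w, x ∈ X ∨ x⁻¹ ∈ X) :
    wordLength X w.prod ≤ w.length :=
  Nat.sInf_le ⟨w, rfl, hw, rfl⟩

theorem wordLength_one : wordLength X (1 : G) = 0 := by
  simpa using wordLength_prod_le (X := X) (w := []) (by simp)

theorem wordLength_mul_le (hgen : Subgroup.closure X = ⊤) (g h : G) :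
    wordLength X (g * h) ≤ wordLength X g + wordLength X h := by
  obtain ⟨v, hv, hvX, rfl⟩ := exists_word_of_closure_eq_top hgen g
  obtain ⟨w, hw, hwX, rfl⟩ := exists_word_of_closure_eq_top hgen h
  rw [← hv, ← hw, ← List.length_append, ← List.prod_append]
  refine wordLength_prod_le fun x hx => ?_
  rcases List.mem_append.1 hx with hx | hx
  exacts [hvX x hx, hwX x hx]

theorem wordLength_inv_le (hgen : Subgroup.closure X = ⊤) (g : G) :
    wordLength X g⁻¹ ≤ wordLength X g := by
  obtain ⟨v, hv, hvX, rfl⟩ := exists_word_of_closure_eq_top hgen g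
  rw [← hv, List.prod_inv_reverse]
  refine (wordLength_prod_le fun x hx => ?_).trans (by simp)
  simp only [List.mem_reverse, List.mem_map] at hx
  obtain ⟨y, hy, rfl⟩ := hx
  simpa using (hvX y hy).symm

theorem wordLength_inv (hgen : Subgroup.closure X = ⊤) (g : G) :
    wordLength X g⁻¹ = wordLength X g :=
  (wordLength_inv_le hgen g).antisymm (by simpa using wordLength_inv_le hgen g⁻¹)

theorem finite_wordLength_le (hgen : Subgroup.closure X = ⊤) (hX : X.Finite) (n : ℕ) :
    {g : G | wordLength X g ≤ n}.Finite := by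
  have hfin : Finite {x : G // x ∈ X ∨ x⁻¹ ∈ X} := by
    refine (hX.union (hX.image (·⁻¹))).subset fun x hx => ?_
    exact hx.imp id fun h => ⟨x⁻¹, h, inv_inv x⟩
  refine ((List.finite_length_le {x : G // x ∈ X ∨ x⁻¹ ∈ X} n).image
    fun l => (l.map Subtype.val).prod).subset fun g hg => ?_
  obtain ⟨w, hw, hwX, rfl⟩ := exists_word_of_closure_eq_top hgen g
  lift w to List {x : G // x ∈ X ∨ x⁻¹ ∈ X} using hwX
  exact ⟨w, by simpa using hw.trans_le hg, rfl⟩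

theorem wordLength_split (hgen : Subgroup.closure X = ⊤) (g : G) (i : ℕ)
    (hi : i ≤ wordLength X g) :
    ∃ a b, a * b = g ∧ wordLength X a = i ∧ wordLength X b + i = wordLength X g := by
  obtain ⟨w, hw, hwX, rfl⟩ := exists_word_of_closure_eq_top hgen g
  have htake : wordLength X (w.take i).prod ≤ (w.take i).length :=
    wordLength_prod_le fun x hx => hwX x (List.mem_of_mem_take hx)
  have hdrop : wordLength X (w.drop i).prod ≤ (w.drop i).length :=
    wordLength_prod_le fun x hx => hwX x (List.mem_of_mem_drop hx)
  have hmul := wordLength_mul_le hgen (w.take i).prod (w.drop i).prod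
  simp only [List.prod_take_mul_prod_drop, List.length_take, List.length_drop] at *
  exact ⟨_, _, List.prod_take_mul_prod_drop w i, by omega, by omega⟩

theorem wordDist_comm (hgen : Subgroup.closure X = ⊤) (a b : G) :
    wordDist X a b = wordDist X b a := by
  rw [wordDist, wordDist, ← wordLength_inv hgen, mul_inv_rev, inv_inv]

theorem wordDist_triangle (hgen : Subgroup.closure X = ⊤) (a b c : G) :
    wordDist X a c ≤ wordDist X a b + wordDist X b c := by
  simpa [wordDist, mul_assoc] using wordLength_mul_le hgen (a⁻¹ * b) (b⁻¹ * c)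

theorem exists_isGeodesic (hgen : Subgroup.closure X = ⊤) (a b : G) :
    ∃ γ, IsGeodesic X a b γ := by
  obtain ⟨w, hw, hwX, hprod⟩ := exists_word_of_closure_eq_top hgen (a⁻¹ * b)
  have hstart : a * (w.take 0).prod = a := by simp
  have hend : a * (w.take (wordDist X a b)).prod = b := by
    rw [wordDist, ← hw, List.take_length, hprod, mul_inv_cancel_left]
  have hle : ∀ i k, wordDist X (a * (w.take i).prod) (a * (w.take (i + k)).prod) ≤ k := by
    intro i k
    have : (a * (w.take i).prod)⁻¹ * (a * (w.take (i + k)).prod) = ((w.drop i).take k).prod := by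
      rw [List.take_add, List.prod_append]; group
    rw [wordDist, this]
    refine (wordLength_prod_le fun x hx =>
      hwX x (List.mem_of_mem_drop (List.mem_of_mem_take hx))).trans ?_
    simp
  have hmono : ∀ i j, i ≤ j → j ≤ wordDist X a b →
      wordDist X (a * (w.take i).prod) (a * (w.take j).prod) = j - i := by
    intro i j hij hj
    have h₁ := hle 0 i
    have h₂ := hle i (j - i)
    have h₃ := hle j (wordDist X a b - j)
    rw [zero_add, hstart] at h₁
    rw [Nat.add_sub_cancel' hij] at h₂
    rw [Nat.add_sub_cancel' hj, hend] at h₃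
    have h₄ := wordDist_triangle hgen a (a * (w.take i).prod) b
    have h₅ := wordDist_triangle hgen (a * (w.take i).prod) (a * (w.take j).prod) b
    omega
  refine ⟨fun i => a * (w.take i).prod, hstart, hend, fun i j hi hj => ?_⟩
  rcases le_total i j with h | h
  · rw [hmono i j h hj, Nat.dist_eq_sub_of_le h]
  · rw [wordDist_comm hgen, hmono j i h hi, Nat.dist_eq_sub_of_le_right h]

theorem IsGeodesic.wordDist_add {a b : G} {γ : ℕ → G} (hγ : IsGeodesic X a b γ) {i : ℕ}
    (hi : i ≤ wordDist X a b) :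
    wordDist X a (γ i) = i ∧ wordDist X (γ i) b + i = wordDist X a b := by
  obtain ⟨h0, h1, h⟩ := hγ
  have hl := h 0 i (Nat.zero_le _) hi
  have hr := h i _ hi le_rfl
  rw [h0] at hl
  rw [h1] at hr
  rw [Nat.dist_eq_sub_of_le (Nat.zero_le _)] at hl
  rw [Nat.dist_eq_sub_of_le hi] at hr
  omega

/-- In a space with thin triangles, a point of a side `[a, c]` is close to being between `a` and
`b` or between `b` and `c`. -/
theorem TrianglesThin.wordDist_add_le {δ : ℕ} (hthin : TrianglesThin X δ)
    (hgen : Subgroup.closure X = ⊤) {a c : G} (b : G) {γ : ℕ → G} (hγ : IsGeodesic X a c γ)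
    {i : ℕ} (hi : i ≤ wordDist X a c) :
    wordDist X a (γ i) + wordDist X (γ i) b ≤ wordDist X a b + 2 * δ ∨
      wordDist X b (γ i) + wordDist X (γ i) c ≤ wordDist X b c + 2 * δ := by
  obtain ⟨γ₁, hγ₁⟩ := exists_isGeodesic hgen a b
  obtain ⟨γ₂, hγ₂⟩ := exists_isGeodesic hgen b c
  obtain ⟨j, ⟨hj, hd⟩ | ⟨hj, hd⟩⟩ := hthin a b c γ₁ γ₂ γ hγ₁ hγ₂ hγ i hi
  · left
    have h₁ := hγ₁.wordDist_add hj
    have h₂ := wordDist_triangle hgen a (γ₁ j) (γ i)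
    have h₃ := wordDist_triangle hgen (γ i) (γ₁ j) b
    rw [wordDist_comm hgen (γ₁ j) (γ i)] at h₂
    omega
  · right
    have h₁ := hγ₂.wordDist_add hj
    have h₂ := wordDist_triangle hgen b (γ₂ j) (γ i)
    have h₃ := wordDist_triangle hgen (γ i) (γ₂ j) c
    rw [wordDist_comm hgen (γ₂ j) (γ i)] at h₂
    omega

theorem TrianglesThin.exists_center {δ : ℕ} (hthin : TrianglesThin X δ)
    (hgen : Subgroup.closure X = ⊤) {a c : G} (b : G) {γ : ℕ → G} (hγ : IsGeodesic X a c γ) :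
    ∃ i ≤ wordDist X a c,
      wordDist X a (γ i) + wordDist X (γ i) b ≤ wordDist X a b + 2 * δ + 2 ∧
      wordDist X b (γ i) + wordDist X (γ i) c ≤ wordDist X b c + 2 * δ + 2 := by
  classical
  have hex : ∃ i, i ≤ wordDist X a c ∧
      wordDist X b (γ i) + wordDist X (γ i) c ≤ wordDist X b c + 2 * δ := by
    refine ⟨_, le_rfl, ?_⟩
    rw [hγ.2.1]
    simp [wordDist, wordLength_one]
  obtain ⟨hi, hbc⟩ := Nat.find_spec hex
  have hmin := fun j (hj : j < Nat.find hex) => Nat.find_min hex hj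
  set i := Nat.find hex
  refine ⟨i, hi, ?_, by omega⟩
  rcases Nat.eq_zero_or_pos i with h0 | hpos
  · rw [h0, hγ.1]
    simp only [wordDist, inv_mul_cancel, wordLength_one]
    omega
  · have hab := (hthin.wordDist_add_le hgen b hγ (i := i - 1) (by omega)).resolve_right
      fun h => hmin (i - 1) (by omega) ⟨by omega, h⟩
    have hstep := hγ.2.2 i (i - 1) hi (by omega)
    rw [Nat.dist_eq_sub_of_le_right (by omega)] at hstep
    have h₁ := wordDist_triangle hgen a (γ (i - 1)) (γ i)
    have h₂ := wordDist_triangle hgen (γ i) (γ (i - 1)) b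
    rw [wordDist_comm hgen (γ (i - 1)) (γ i)] at h₁
    omega

theorem TrianglesThin.isHyperbolicLength {δ : ℕ} (hthin : TrianglesThin X δ)
    (hgen : Subgroup.closure X = ⊤) (hX : X.Finite) :
    IsHyperbolicLength (wordLength X) (4 * δ + 2) where
  one := wordLength_one
  inv := wordLength_inv hgen
  mul_le := wordLength_mul_le hgen
  finite_ball := finite_wordLength_le hgen hX
  exists_split := wordLength_split hgen
  four_point x y z w := by
    change wordDist X x z + wordDist X y w ≤ wordDist X x y + wordDist X z w + _ ∨
      wordDist X x z + wordDist X y w ≤ wordDist X x w + wordDist X y z + _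
    obtain ⟨γ, hγ⟩ := exists_isGeodesic hgen x z
    obtain ⟨i, hi, h₁, h₂⟩ := hthin.exists_center hgen y hγ
    have h₃ := hγ.wordDist_add hi
    have h₄ := wordDist_triangle hgen y (γ i) w
    rw [wordDist_comm hgen (γ i) y] at h₁
    have h₅ := wordDist_comm hgen w (γ i)
    have h₆ := wordDist_comm hgen w z
    rcases hthin.wordDist_add_le hgen w hγ hi with h | h
    · right; omega
    · left; omega

end WordLength

section Ultralimit

open Filter

theorem Ultrafilter.exists_eventually_eq_int {ι : Type*} (ω : Ultrafilter ι) (f : ι → ℤ) (B : ℕ)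
    (hf : ∀ n, |f n| ≤ B) : ∃ c : ℤ, ∀ᶠ n in ω, f n = c := by
  obtain ⟨c, -, hc⟩ := (ω.eventually_exists_mem_iff (P := fun c n => f n = c)
    (Set.finite_Icc (-(B : ℤ)) B)).1
    (Eventually.of_forall fun n => ⟨f n, abs_le.1 (hf n), rfl⟩)
  exact ⟨c, hc⟩

namespace IsHyperbolicLength

variable {G : Type*} [Group G] {L : G → ℕ} {E : ℕ}

theorem le_mul_add (hL : IsHyperbolicLength L E) (u g : G) : L g ≤ L (u * g) + L u := by
  have := hL.mul_le u⁻¹ (u * g)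
  rw [inv_mul_cancel_left, hL.inv] at this
  omega

theorem le_mul_add' (hL : IsHyperbolicLength L E) (g u : G) : L g ≤ L (g * u) + L u := by
  have := hL.mul_le (g * u) u⁻¹
  rw [mul_inv_cancel_right, hL.inv] at this
  omega

theorem inv_mul_comm (hL : IsHyperbolicLength L E) (g h : G) : L (g⁻¹ * h) = L (h⁻¹ * g) := by
  rw [← hL.inv, mul_inv_rev, inv_inv]

theorem conj_mul_le (hL : IsHyperbolicLength L E) (u v h : G) :
    L (h⁻¹ * (u * v * h)) ≤
      max (L (h⁻¹ * (u * h))) (L (h⁻¹ * (v * h))) + L (u * v) + L u + E := by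
  have h₁ := hL.four_point h 1 (u * v * h) (u * h)
  have h₂ : L ((u * v * h)⁻¹ * (u * h)) = L (h⁻¹ * (v * h)) := by
    rw [hL.inv_mul_comm]; congr 1; group
  rw [h₂] at h₁
  simp only [inv_one, one_mul, mul_one, hL.inv] at h₁
  have h₃ := hL.le_mul_add u h
  have h₄ := hL.mul_le (u * v) h
  omega

/-- The elements that fix the direction of the sequence `h` along the ultrafilter `ω`. -/
def directionStabilizer (hL : IsHyperbolicLength L E) {h : ℕ → G} {ω : Ultrafilter ℕ}
    (hh : ∀ C, ∀ᶠ n in ω, C ≤ L (h n)) : Subgroup G where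
  carrier := {u | ∀ C, ∀ᶠ n in ω, L ((h n)⁻¹ * (u * h n)) + C ≤ 2 * L (h n)}
  one_mem' C := by
    filter_upwards [hh C] with n hn
    rw [one_mul, inv_mul_cancel, hL.one]
    omega
  mul_mem' {u v} hu hv C := by
    filter_upwards [hu (C + L (u * v) + L u + E), hv (C + L (u * v) + L u + E)] with n hun hvn
    have := hL.conj_mul_le u v (h n)
    omega
  inv_mem' {u} hu C := by
    filter_upwards [hu C] with n hn
    rwa [hL.inv_mul_comm, mul_inv_rev, inv_inv, mul_assoc]

variable {h : ℕ → G} {ω : Ultrafilter ℕ}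

theorem mem_directionStabilizer (hL : IsHyperbolicLength L E)
    (hh : ∀ C, ∀ᶠ n in ω, C ≤ L (h n)) {u : G} : u ∈ hL.directionStabilizer hh ↔
      ∀ C, ∀ᶠ n in ω, L ((h n)⁻¹ * (u * h n)) + C ≤ 2 * L (h n) :=
  Iff.rfl

theorem exists_eventually_sub_eq (hL : IsHyperbolicLength L E) (h : ℕ → G) (ω : Ultrafilter ℕ)
    (u : G) : ∃ c : ℤ, ∀ᶠ n in ω, (L (u * h n) : ℤ) - L (h n) = c := by
  refine ω.exists_eventually_eq_int _ (L u) fun n => ?_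
  have h₁ := hL.mul_le u (h n)
  have h₂ := hL.le_mul_add u (h n)
  rw [abs_le]
  omega

/-- The Busemann function at the limit of the sequence `h` along the ultrafilter `ω`. -/
noncomputable def busemann (hL : IsHyperbolicLength L E) (h : ℕ → G) (ω : Ultrafilter ℕ)
    (u : G) : ℤ :=
  (hL.exists_eventually_sub_eq h ω u).choose

theorem eventually_busemann (hL : IsHyperbolicLength L E) (h : ℕ → G) (ω : Ultrafilter ℕ)
    (u : G) : ∀ᶠ n in ω, (L (u * h n) : ℤ) - L (h n) = hL.busemann h ω u :=
  (hL.exists_eventually_sub_eq h ω u).choose_spec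

theorem busemann_one (hL : IsHyperbolicLength L E) (h : ℕ → G) (ω : Ultrafilter ℕ) :
    hL.busemann h ω 1 = 0 := by
  obtain ⟨n, hn⟩ := (hL.eventually_busemann h ω 1).exists
  simpa using hn.symm

theorem abs_busemann_mul_sub_le (hL : IsHyperbolicLength L E)
    (hh : ∀ C, ∀ᶠ n in ω, C ≤ L (h n)) {v : G} (hv : v ∈ hL.directionStabilizer hh) (u : G) :
    |hL.busemann h ω (u * v) - hL.busemann h ω u - hL.busemann h ω v| ≤ E := by
  obtain ⟨n, h₁, h₂, h₃, h₄⟩ := ((hL.eventually_busemann h ω (u * v)).and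
    ((hL.eventually_busemann h ω u).and ((hL.eventually_busemann h ω v).and
      (hv (2 * L u + L v + E + 1))))).exists
  rw [← h₁, ← h₂, ← h₃]
  generalize h n = g at *
  have p₁ := hL.four_point u⁻¹ 1 (v * g) g
  have p₂ := hL.four_point u⁻¹ 1 g (v * g)
  rw [hL.inv_mul_comm (v * g) g] at p₁
  simp only [inv_one, one_mul, mul_one, inv_inv, ← mul_assoc] at p₁ p₂ h₄ ⊢
  have q₁ := hL.le_mul_add v g
  have q₂ := hL.le_mul_add (u * v) g
  have q₃ := hL.le_mul_add u g
  have q₄ := hL.le_mul_add u (v * g)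
  simp only [← mul_assoc] at q₄
  rw [abs_le]
  omega

theorem length_conj_le (hL : IsHyperbolicLength L E) {u p q : G} {T : ℕ}
    (hu : 3 * L u + E + T ≤ L p)
    (hfar : L ((p * q)⁻¹ * (u * (p * q))) + 2 * L p + L u + E ≤ 2 * L (p * q))
    (hpq : L q + L p = L (p * q))
    (hT : |(L (u * (p * q)) : ℤ) - L (p * q)| ≤ T) :
    L (p⁻¹ * (u * p)) ≤ T + 3 * E := by
  rw [abs_le] at hT
  have hq : L (p⁻¹ * (p * q)) = L q := by rw [inv_mul_cancel_left]
  have hup : L ((u * p)⁻¹ * (u * (p * q))) = L q := by congr 1; group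
  have huu : L (u⁻¹ * (u * p)) = L p := by rw [inv_mul_cancel_left]
  have huuh : L (u⁻¹ * (u * (p * q))) = L (p * q) := by rw [inv_mul_cancel_left]
  have h₁ := hL.four_point 1 p (p * q) (u * (p * q))
  have h₂ := hL.four_point u 1 p (u * (p * q))
  have h₃ := hL.four_point p u (u * p) (u * (p * q))
  rw [hL.inv_mul_comm p u] at h₃
  simp only [inv_one, one_mul, mul_one, hL.inv] at h₁ h₂ h₃
  have h₄ := hL.mul_le u (p * q)
  omega

theorem finite_abs_busemann_le (hL : IsHyperbolicLength L E)
    (hh : ∀ C, ∀ᶠ n in ω, C ≤ L (h n)) (T : ℕ) :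
    {u | u ∈ hL.directionStabilizer hh ∧ |hL.busemann h ω u| ≤ T}.Finite := by
  by_contra hinf
  obtain ⟨F, hF, hcard⟩ := Set.Infinite.exists_subset_card_eq hinf
    ({g | L g ≤ T + 3 * E}.ncard + 1)
  set r := F.sup L
  have hr : ∀ u ∈ F, L u ≤ r := fun u hu => Finset.le_sup hu
  set t := 3 * r + E + T
  have hev : ∀ᶠ n in ω, ∀ u ∈ F, (L (u * h n) : ℤ) - L (h n) = hL.busemann h ω u ∧
      L ((h n)⁻¹ * (u * h n)) + (2 * t + r + E) ≤ 2 * L (h n) :=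
    (Finset.eventually_all F).2 fun u hu => (hL.eventually_busemann h ω u).and ((hF hu).1 _)
  obtain ⟨n, hn, hF'⟩ := ((hh t).and hev).exists
  obtain ⟨p, q, hpq, hp, hq⟩ := hL.exists_split (h n) t hn
  rw [← hpq] at hF' hq
  have hle := Set.ncard_le_ncard_of_injOn (s := (F : Set G)) (t := {g | L g ≤ T + 3 * E})
    (fun u => p⁻¹ * (u * p)) (fun u hu => ?_) (fun u _ v _ huv => by simpa using huv)
    (hL.finite_ball _)
  · rw [Set.ncard_coe_finset] at hle
    omega
  · have h₁ := hr u hu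
    obtain ⟨h₂, h₃⟩ := hF' u hu
    refine hL.length_conj_le (q := q) (by omega) (by omega) (by omega) ?_
    rw [h₂]
    exact (hF hu).2

theorem _root_.Subgroup.finiteIndex_of_finite_cover (K : Subgroup G) {F : Set G} (hF : F.Finite)
    (hcov : ∀ g, ∃ f ∈ F, f * g⁻¹ ∈ K) : K.FiniteIndex := by
  have := hF.to_subtype
  have hsurj : Function.Surjective fun f : F => (((f : G)⁻¹ : G) : G ⧸ K) := by
    intro x
    obtain ⟨g, rfl⟩ := QuotientGroup.mk_surjective x
    obtain ⟨f, hf, hfg⟩ := hcov g⁻¹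
    refine ⟨⟨f, hf⟩, QuotientGroup.eq.2 ?_⟩
    simpa only [inv_inv] using hfg
  have := Finite.of_surjective _ hsurj
  exact Subgroup.finiteIndex_of_finite_quotient

theorem exists_finite_cover (hL : IsHyperbolicLength L E) (hh : ∀ C, ∀ᶠ n in ω, C ≤ L (h n))
    {u : G} (hu : u ∈ hL.directionStabilizer hh) (hbu : 2 * (E : ℤ) < |hL.busemann h ω u|) :
    ∃ F : Set G, F.Finite ∧ ∀ v ∈ hL.directionStabilizer hh,
      ∃ k : ℤ, u ^ k * v ∈ F := by
  refine ⟨_, hL.finite_abs_busemann_le hh ((hL.busemann h ω u).natAbs + E), fun v hv => ?_⟩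
  have hmem : ∀ k : ℤ, u ^ k * v ∈ hL.directionStabilizer hh := fun k =>
    mul_mem (zpow_mem hu k) hv
  let f : ℤ → ℕ := fun k => (hL.busemann h ω (u ^ k * v)).natAbs
  let k := Function.argmin f
  refine ⟨k, hmem k, ?_⟩
  have hup : f k ≤ f (1 + k) := Function.argmin_le f _
  have hdown : f k ≤ f (-1 + k) := Function.argmin_le f _
  simp only [f, zpow_add, zpow_one, zpow_neg_one, mul_assoc] at hup hdown
  have h₁ := hL.abs_busemann_mul_sub_le hh (hmem k) u
  have h₂ := hL.abs_busemann_mul_sub_le hh (hmem k) u⁻¹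
  have h₃ := hL.abs_busemann_mul_sub_le hh hu u⁻¹
  rw [inv_mul_cancel, hL.busemann_one] at h₃
  generalize hL.busemann h ω (u ^ k * v) = x at *
  rw [abs_le] at *
  rw [lt_abs] at hbu
  omega

theorem virtuallyCyclic_of_finiteIndex (hL : IsHyperbolicLength L E) [Infinite G]
    (hh : ∀ C, ∀ᶠ n in ω, C ≤ L (h n)) (hfin : (hL.directionStabilizer hh).FiniteIndex) :
    VirtuallyCyclic G := by
  by_cases hb : ∃ u ∈ hL.directionStabilizer hh, 2 * (E : ℤ) < |hL.busemann h ω u|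
  · obtain ⟨u, hu, hbu⟩ := hb
    obtain ⟨F, hF, hcov⟩ := hL.exists_finite_cover hh hu hbu
    refine ⟨Subgroup.zpowers u, inferInstance, ⟨?_⟩⟩
    have hle : Subgroup.zpowers u ≤ hL.directionStabilizer hh := by simpa using hu
    rw [← Subgroup.relIndex_mul_index hle]
    refine mul_ne_zero ?_ hfin.index_ne_zero
    have : ((Subgroup.zpowers u).subgroupOf (hL.directionStabilizer hh)).FiniteIndex := by
      refine Subgroup.finiteIndex_of_finite_cover _
        (hF.preimage Subtype.val_injective.injOn) fun g => ?_
      obtain ⟨k, hk⟩ := hcov g g.2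
      refine ⟨⟨u ^ k, zpow_mem hu k⟩ * g, hk, ?_⟩
      simp [Subgroup.mem_subgroupOf]
    exact this.index_ne_zero
  · push Not at hb
    have : Finite (hL.directionStabilizer hh) :=
      (hL.finite_abs_busemann_le hh (2 * E)).subset fun u hu => ⟨hu, by exact_mod_cast hb u hu⟩
    exact absurd
      ((Subgroup.finite_iff_finite_and_finiteIndex _).2 ⟨this, hfin⟩)
      (not_finite_iff_infinite.2 inferInstance)

theorem exists_separated_translates (hL : IsHyperbolicLength L E) [Infinite G]
    (hG : ¬ VirtuallyCyclic G) (k : ℕ) :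
    ∃ N : ℕ, ∀ g : G, N ≤ L g → ∃ u : Fin k → G, (∀ i, L (u i) ≤ N) ∧
      ∀ i j, i ≠ j → 2 * L g ≤ L ((u i * g)⁻¹ * (u j * g)) + N := by
  by_contra! hcon
  choose h hlen hbad using hcon
  have hh : ∀ C, ∀ᶠ n in hyperfilter ℕ, C ≤ L (h n) := fun C =>
    ((eventually_ge_atTop C).filter_mono Nat.hyperfilter_le_atTop).mono
      fun n hn => hn.trans (hlen n)
  have hinf : Infinite (G ⧸ hL.directionStabilizer hh) := by
    by_contra hfin
    have := not_infinite_iff_finite.1 hfin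
    exact hG (hL.virtuallyCyclic_of_finiteIndex hh Subgroup.finiteIndex_of_finite_quotient)
  let x := Infinite.natEmbedding (G ⧸ hL.directionStabilizer hh)
  let u : Fin k → G := fun i => (x i).out
  have hu : ∀ i j, i ≠ j → ∃ C, ∀ᶠ n in hyperfilter ℕ,
      2 * L (h n) < L ((u i * h n)⁻¹ * (u j * h n)) + C := by
    intro i j hij
    have hmem : (u i)⁻¹ * u j ∉ hL.directionStabilizer hh := by
      rw [← QuotientGroup.eq]
      simpa [u, Fin.val_inj] using hij
    rw [mem_directionStabilizer] at hmem
    push Not at hmem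
    obtain ⟨C, hC⟩ := hmem
    refine ⟨C, hC.mono fun n hn => ?_⟩
    simpa [mul_assoc] using hn
  choose! C hC using hu
  have hev : ∀ᶠ n in hyperfilter ℕ, ∀ i j, i ≠ j →
      2 * L (h n) ≤ L ((u i * h n)⁻¹ * (u j * h n)) + n := by
    simp only [eventually_all]
    intro i j hij
    filter_upwards [hC i j hij,
      (eventually_ge_atTop (C i j)).filter_mono Nat.hyperfilter_le_atTop] with n hn hCn
    omega
  have hlt : ∀ᶠ n in hyperfilter ℕ, ∀ i, L (u i) ≤ n := by
    simp only [eventually_all]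
    exact fun i => (eventually_ge_atTop _).filter_mono Nat.hyperfilter_le_atTop
  obtain ⟨n, hn, hn'⟩ := (hev.and hlt).exists
  obtain ⟨i, j, hij, hlt⟩ := hbad n u hn'
  exact absurd (hn i j hij) (by omega)

theorem exists_connector (hL : IsHyperbolicLength L E) [Infinite G] (hG : ¬ VirtuallyCyclic G) :
    ∃ C : ℕ, ∀ g h : G, ∃ u, L u ≤ C ∧ L g + L h ≤ L (g * u * h) + C := by
  obtain ⟨N, hN⟩ := hL.exists_separated_translates hG 2
  refine ⟨2 * N + E, fun g h => ?_⟩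
  rcases lt_or_ge (L h) N with hlt | hge
  · refine ⟨1, by simp [hL.one], ?_⟩
    have := hL.le_mul_add' g h
    rw [mul_one]
    omega
  · obtain ⟨u, hu, hsep⟩ := hN h hge
    have h₁ := hL.four_point g⁻¹ (u 0 * h) 1 (u 1 * h)
    have h₂ := hsep 0 1 (by decide)
    have h₃ := hL.le_mul_add (u 0) h
    have h₄ := hL.le_mul_add (u 1) h
    have h₅ := hu 0
    have h₆ := hu 1
    have h₇ := hL.mul_le (u 0) h
    have h₈ := hL.mul_le (u 1) h
    simp only [inv_inv, inv_one, one_mul, mul_one, hL.inv, ← mul_assoc] at h₁ h₂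
    rcases h₁ with h₁ | h₁
    · exact ⟨u 0, by omega, by omega⟩
    · exact ⟨u 1, by omega, by omega⟩

theorem finite_sphere (hL : IsHyperbolicLength L E) (n : ℕ) : {g | L g = n}.Finite :=
  (hL.finite_ball n).subset fun _ hg => le_of_eq hg

theorem exists_le_length (hL : IsHyperbolicLength L E) [Infinite G] (n : ℕ) : ∃ g, n ≤ L g := by
  obtain ⟨g, hg⟩ := (hL.finite_ball n).exists_notMem
  exact ⟨g, (not_le.1 hg).le⟩

theorem sphere_ncard_pos (hL : IsHyperbolicLength L E) [Infinite G] (n : ℕ) :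
    0 < {g | L g = n}.ncard := by
  obtain ⟨g, hg⟩ := hL.exists_le_length n
  obtain ⟨a, -, -, ha, -⟩ := hL.exists_split g n hg
  exact (Set.ncard_pos (hL.finite_sphere n)).2 ⟨a, ha⟩

theorem sphere_ncard_add_le (hL : IsHyperbolicLength L E) (n m : ℕ) :
    {g | L g = n + m}.ncard ≤ {g | L g = n}.ncard * {g | L g = m}.ncard := by
  have hfin := (hL.finite_sphere n).prod (hL.finite_sphere m)
  rw [← Set.ncard_prod]
  refine (Set.ncard_le_ncard (fun g hg => ?_) (hfin.image fun p => p.1 * p.2)).trans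
    (Set.ncard_image_le hfin)
  obtain ⟨a, b, hab, ha, hb⟩ := hL.exists_split g n (by rw [hg]; omega)
  rw [Set.mem_ofPred_eq] at hg
  exact ⟨(a, b), ⟨ha, show L b = m by omega⟩, hab⟩

theorem exists_lt_sphere_ncard (hL : IsHyperbolicLength L E) [Infinite G]
    (hG : ¬ VirtuallyCyclic G) (K : ℕ) : ∃ n, K < {g | L g = n}.ncard := by
  obtain ⟨N, hN⟩ := hL.exists_separated_translates hG (K + 1)
  obtain ⟨g, hg⟩ := hL.exists_le_length (4 * N + 1)
  obtain ⟨u, hu, hsep⟩ := hN g (by omega)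
  have hsplit : ∀ i, ∃ a b, a * b = u i * g ∧ L a = L g - N ∧ L b + (L g - N) = L (u i * g) :=
    fun i => hL.exists_split _ _ (by have := hL.le_mul_add (u i) g; have := hu i; omega)
  choose a b hab ha hb using hsplit
  refine ⟨L g - N, ?_⟩
  have hinj : Function.Injective a := by
    intro i j hij
    by_contra hne
    have h₁ := hsep i j hne
    have h₂ : (u i * g)⁻¹ * (u j * g) = (b i)⁻¹ * b j := by
      rw [← hab i, ← hab j, hij]; group
    have h₃ := hL.mul_le (b i)⁻¹ (b j)
    rw [hL.inv, ← h₂] at h₃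
    have h₄ := hL.mul_le (u i) g
    have h₅ := hL.mul_le (u j) g
    have := hb i
    have := hb j
    have := hu i
    have := hu j
    omega
  have := Set.ncard_le_ncard (Set.range_subset_iff.2 ha) (hL.finite_sphere (L g - N))
  rw [Set.ncard_range_of_injective hinj, Nat.card_fin] at this
  omega

theorem length_inv_mul_le_of_connector (hL : IsHyperbolicLength L E) {g u h a : G} {C : ℕ}
    (hu : L u ≤ C) (hguh : L g + L h ≤ L (g * u * h) + C)
    (ha : L a = min (L g) (L (g * u * h)))
    (hb : L (a⁻¹ * (g * u * h)) + L a = L (g * u * h)) :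
    L (a⁻¹ * g) ≤ 2 * C + E := by
  have h₁ := hL.four_point a 1 g (g * u * h)
  have h₂ : L (g⁻¹ * (g * u * h)) ≤ L u + L h := by
    rw [mul_assoc, inv_mul_cancel_left]
    exact hL.mul_le u h
  simp only [inv_one, one_mul, mul_one, hL.inv] at h₁
  omega

theorem exists_sphere_ncard_mul_le (hL : IsHyperbolicLength L E) [Infinite G]
    (hG : ¬ VirtuallyCyclic G) :
    ∃ M C : ℕ, ∀ n m, ∃ l, l ≤ n + m + C ∧
      n + m ≤ l + C ∧ {g | L g = n}.ncard * {g | L g = m}.ncard ≤ M * {g | L g = l}.ncard := by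
  obtain ⟨C, hC⟩ := hL.exists_connector hG
  choose u hu huC using hC
  refine ⟨(2 * C + 1) * ({g | L g ≤ 2 * C + E}.ncard * {g | L g ≤ C}.ncard), C, fun n m => ?_⟩
  have hpre : ∀ k, ∃ a, L a = min n (L k) ∧ L (a⁻¹ * k) + L a = L k := by
    intro k
    obtain ⟨a, b, rfl, ha, hb⟩ := hL.exists_split k (min n (L k)) (min_le_right _ _)
    exact ⟨a, ha, by rw [inv_mul_cancel_left, ha, hb]⟩
  choose a ha hak using hpre
  set I := Finset.Icc (n + m - C) (n + m + C)
  set T : Set G := ⋃ l ∈ I, {g | L g = l}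
  have hT : T.Finite := I.finite_toSet.biUnion fun l _ => hL.finite_sphere l
  let φ : G × G → G × G × G := fun p =>
    (p.1 * u p.1 p.2 * p.2, (a (p.1 * u p.1 p.2 * p.2))⁻¹ * p.1, u p.1 p.2)
  have hle := Set.ncard_le_ncard_of_injOn (s := {g | L g = n} ×ˢ {g | L g = m})
    (t := T ×ˢ ({g | L g ≤ 2 * C + E} ×ˢ {g | L g ≤ C})) φ ?_ ?_
    (hT.prod ((hL.finite_ball _).prod (hL.finite_ball _)))
  · rw [Set.ncard_prod, Set.ncard_prod, Set.ncard_prod] at hle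
    have hne : I.Nonempty := Finset.nonempty_Icc.2 (by omega)
    obtain ⟨l, hl, hmax⟩ := I.exists_max_image (fun l => {g | L g = l}.ncard) hne
    refine ⟨l, (Finset.mem_Icc.1 hl).2, by have := (Finset.mem_Icc.1 hl).1; omega, ?_⟩
    have hTcard : T.ncard ≤ (2 * C + 1) * {g | L g = l}.ncard := by
      calc T.ncard ≤ ∑ l ∈ I, {g | L g = l}.ncard := Finset.set_ncard_biUnion_le _ _
        _ ≤ I.card * {g | L g = l}.ncard := by
          simpa using Finset.sum_le_card_nsmul I _ _ hmax
        _ ≤ (2 * C + 1) * {g | L g = l}.ncard := by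
          gcongr
          rw [Nat.card_Icc]
          omega
    calc _ ≤ _ := hle
      _ ≤ _ := Nat.mul_le_mul_right _ hTcard
      _ = _ := by ring
  · rintro ⟨g, h⟩ ⟨hg, hh⟩
    simp only [Set.mem_ofPred_eq] at hg hh
    have h₁ := hu g h
    have h₂ := huC g h
    have h₃ := hL.mul_le (g * u g h) h
    have h₄ := hL.mul_le g (u g h)
    refine ⟨Set.mem_biUnion (x := L (g * u g h * h)) ?_ rfl, ?_, h₁⟩
    · simp only [I, Finset.coe_Icc, Set.mem_Icc]
      omega
    · exact hL.length_inv_mul_le_of_connector h₁ h₂ (hg ▸ ha _) (hak _)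
  · rintro ⟨g, h⟩ - ⟨g', h'⟩ - heq
    simp only [φ, Prod.mk.injEq] at heq
    obtain ⟨h₁, h₂, h₃⟩ := heq
    rw [h₁, mul_right_inj] at h₂
    subst h₂
    rw [h₃, mul_right_inj] at h₁
    rw [h₁]

end IsHyperbolicLength

end Ultralimit

section Fekete

open Filter Topology

/-- A non-negative sequence which grows sublinearly and is superadditive up to bounded errors in
the index and in the value is bounded. -/
theorem le_of_almost_superadditive {v : ℕ → ℝ} {c : ℝ} {C : ℕ}
    (hv : Tendsto (fun n => v n / n) atTop (𝓝 0))
    (hsup : ∀ n m, ∃ l ≤ n + m + C, v n + v m ≤ v l + c) (n : ℕ) : v n ≤ c := by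
  by_contra! hlt
  have hiter : ∀ k : ℕ, ∃ l : ℕ, l + C ≤ 2 ^ k * (n + C) ∧ 2 ^ k * (v n - c) ≤ v l - c := by
    intro k
    induction k with
    | zero => exact ⟨n, by simp, by simp⟩
    | succ k ih =>
      obtain ⟨l, hl, hvl⟩ := ih
      obtain ⟨l', hl', hvl'⟩ := hsup l l
      exact ⟨l', by rw [pow_succ]; linarith, by rw [pow_succ]; linarith⟩
  set ε := (v n - c) / (n + C + 1)
  have hd : (0 : ℝ) < n + C + 1 := by positivity
  have hε : 0 < ε := div_pos (sub_pos.2 hlt) hd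
  obtain ⟨B, hB⟩ : ∃ B, ∀ l, v l ≤ ε / 2 * l + B := by
    obtain ⟨N, hN⟩ := eventually_atTop.1 (hv.eventually (gt_mem_nhds (half_pos hε)))
    obtain ⟨B, hB⟩ := ((Set.finite_Iic N).image v).bddAbove
    refine ⟨max B 0, fun l => ?_⟩
    rcases le_or_gt l N with hl | hl
    · have := hB (Set.mem_image_of_mem v (Set.mem_Iic.2 hl))
      have : 0 ≤ ε / 2 * l := by positivity
      linarith [le_max_left B 0]
    · have hlpos : (0 : ℝ) < l := by exact_mod_cast (Nat.zero_le N).trans_lt hl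
      have := (div_lt_iff₀ hlpos).1 (hN l hl.le)
      linarith [le_max_right B 0]
  have hbig : Tendsto (fun k : ℕ => (2 : ℝ) ^ k * ((v n - c) / 2)) atTop atTop :=
    (tendsto_pow_atTop_atTop_of_one_lt one_lt_two).atTop_mul_const (by linarith)
  obtain ⟨k, hk⟩ := (hbig.eventually_gt_atTop (B - c)).exists
  obtain ⟨l, hl, hvl⟩ := hiter k
  have hl' : (l : ℝ) ≤ 2 ^ k * (n + C + 1) := by
    have : (l : ℝ) + C ≤ 2 ^ k * (n + C) := by exact_mod_cast hl
    have : (0 : ℝ) < 2 ^ k := by positivity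
    have : (0 : ℝ) ≤ C := by positivity
    linarith
  have hmul : ε / 2 * l ≤ 2 ^ k * ((v n - c) / 2) := by
    calc ε / 2 * l ≤ ε / 2 * (2 ^ k * (n + C + 1)) := by gcongr
      _ = 2 ^ k * ((v n - c) / 2) := by simp only [ε]; field_simp
  linarith [hB l]

/-- A submultiplicative sequence of positive integers which is supermultiplicative up to bounded
errors is comparable to a geometric sequence. -/
theorem exists_geometric_bounds {S : ℕ → ℕ} (hpos : ∀ n, 0 < S n)
    (hsub : ∀ n m, S (n + m) ≤ S n * S m) {M C : ℕ}
    (hsup : ∀ n m, ∃ l, l ≤ n + m + C ∧ n + m ≤ l + C ∧ S n * S m ≤ M * S l) :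
    ∃ lam K : ℝ, 1 ≤ lam ∧ 1 ≤ K ∧ ∀ n, lam ^ n ≤ S n ∧ S n ≤ K * lam ^ n := by
  have hone : ∀ n, (1 : ℝ) ≤ S n := fun n => by exact_mod_cast hpos n
  have hM : 0 < M := by
    obtain ⟨l, -, -, h⟩ := hsup 0 0
    exact Nat.pos_of_ne_zero fun h0 => by
      have := Nat.mul_pos (hpos 0) (hpos 0)
      rw [h0, zero_mul] at h
      exact this.not_ge h
  let u : ℕ → ℝ := fun n => Real.log (S n)
  have hu : Subadditive u := by
    intro n m
    simp only [u]
    rw [← Real.log_mul (by linarith [hone n]) (by linarith [hone m])]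
    exact Real.log_le_log (by linarith [hone (n + m)]) (by exact_mod_cast hsub n m)
  have hu0 : ∀ n, 0 ≤ u n := fun n => Real.log_nonneg (hone n)
  have hbdd : BddBelow (Set.range fun n => u n / n) := by
    refine ⟨0, ?_⟩
    rintro _ ⟨n, rfl⟩
    exact div_nonneg (hu0 n) (Nat.cast_nonneg n)
  have hlim := hu.tendsto_lim hbdd
  set ℓ := hu.lim
  have hℓ : 0 ≤ ℓ := ge_of_tendsto' hlim fun n => div_nonneg (hu0 n) (Nat.cast_nonneg n)
  have hlow : ∀ n : ℕ, n * ℓ ≤ u n := by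
    intro n
    rcases Nat.eq_zero_or_pos n with rfl | hn
    · simpa using hu0 0
    · have := (le_div_iff₀ (by exact_mod_cast hn)).1 (hu.lim_le_div hbdd hn.ne')
      linarith
  have hup : ∀ n : ℕ, u n - n * ℓ ≤ Real.log M + C * ℓ := by
    refine le_of_almost_superadditive (C := C) ?_ fun n m => ?_
    · have : Tendsto (fun n : ℕ => u n / n - ℓ) atTop (𝓝 0) := by simpa using hlim.sub_const ℓ
      refine this.congr' ((eventually_gt_atTop 0).mono fun n hn => ?_)
      have : (n : ℝ) ≠ 0 := by exact_mod_cast hn.ne'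
      field_simp
    · obtain ⟨l, hl, hl', h⟩ := hsup n m
      refine ⟨l, hl, ?_⟩
      have h₁ : u n + u m ≤ Real.log M + u l := by
        simp only [u]
        rw [← Real.log_mul (by linarith [hone n]) (by linarith [hone m]),
          ← Real.log_mul (by positivity) (by linarith [hone l])]
        refine Real.log_le_log ?_ (by exact_mod_cast h)
        exact mul_pos (by linarith [hone n]) (by linarith [hone m])
      have h₂ : (l : ℝ) ≤ n + m + C := by exact_mod_cast hl
      nlinarith
  have hexp : ∀ n : ℕ, Real.exp ℓ ^ n = Real.exp (n * ℓ) := fun n => (Real.exp_nat_mul ℓ n).symm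
  refine ⟨Real.exp ℓ, Real.exp (Real.log M + C * ℓ), Real.one_le_exp hℓ, Real.one_le_exp ?_,
    fun n => ⟨?_, ?_⟩⟩
  · have := Real.log_nonneg (show (1 : ℝ) ≤ M by exact_mod_cast hM)
    positivity
  · rw [hexp, ← Real.le_log_iff_exp_le (by linarith [hone n])]
    exact hlow n
  · rw [hexp, ← Real.exp_add, ← Real.log_le_iff_le_exp (by linarith [hone n])]
    linarith [hup n]

end Fekete

/-- **Coornaert's theorem.** Let `G` be a non-elementary word-hyperbolic group with a finite
generating set `X`. Then there are constants `λ, D > 1` with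
`D⁻¹ λ^n ≤ 𝔅(n) ≤ D λ^n` for all `n ≥ 0`. -/
theorem coornaert_ball_growth {G : Type*} [Group G] (X : Finset G)
    (hgen : Subgroup.closure (X : Set G) = ⊤)
    (hhyp : ∃ δ : ℕ, 1 ≤ δ ∧ TrianglesThin (X : Set G) δ)
    (hinf : Infinite G) (hne : ¬ VirtuallyCyclic G) :
    ∃ lam D : ℝ, 1 < lam ∧ 1 < D ∧
      ∀ n : ℕ, D⁻¹ * lam ^ n ≤ (ballCard (X : Set G) n : ℝ) ∧
        (ballCard (X : Set G) n : ℝ) ≤ D * lam ^ n := by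
  obtain ⟨δ, -, hthin⟩ := hhyp
  have hL := hthin.isHyperbolicLength hgen X.finite_toSet
  obtain ⟨M, C, hsup⟩ := hL.exists_sphere_ncard_mul_le hne
  obtain ⟨lam, K, hlam, hK, hbounds⟩ :=
    exists_geometric_bounds hL.sphere_ncard_pos hL.sphere_ncard_add_le hsup
  have hlam' : 1 < lam := by
    refine lt_of_le_of_ne hlam fun h => ?_
    obtain ⟨n, hn⟩ := hL.exists_lt_sphere_ncard hne ⌈K⌉₊
    have := (hbounds n).2
    rw [← h, one_pow, mul_one] at this
    exact absurd (Nat.lt_of_ceil_lt hn) this.not_gt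
  have hsub : 0 < lam - 1 := sub_pos.2 hlam'
  have hD : 1 < K * (lam / (lam - 1)) := by
    have : 1 < lam / (lam - 1) := (one_lt_div hsub).2 (by linarith)
    nlinarith
  refine ⟨lam, K * (lam / (lam - 1)), hlam', hD, fun n => ⟨?_, ?_⟩⟩
  · calc _ ≤ 1 * lam ^ n := by
          gcongr
          exact inv_le_one_of_one_le₀ hD.le
      _ ≤ ({g | wordLength (X : Set G) g = n}.ncard : ℝ) := by
          rw [one_mul]
          exact (hbounds n).1
      _ ≤ _ := by
          exact_mod_cast Set.ncard_le_ncard (fun g (hg : _ = n) => hg.le) (hL.finite_ball n)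
  · have hball : ballCard (X : Set G) n ≤
        ∑ i ∈ Finset.range (n + 1), {g | wordLength (X : Set G) g = i}.ncard := by
      refine (Set.ncard_le_ncard (fun g hg => ?_) ?_).trans (Finset.set_ncard_biUnion_le _ _)
      · exact Set.mem_biUnion (x := wordLength (X : Set G) g)
          (by simpa [Nat.lt_succ_iff] using hg) rfl
      · exact (Finset.range (n + 1)).finite_toSet.biUnion fun i _ => hL.finite_sphere i
    calc (ballCard (X : Set G) n : ℝ)
        ≤ ∑ i ∈ Finset.range (n + 1), ({g | wordLength (X : Set G) g = i}.ncard : ℝ) := by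
          exact_mod_cast hball
      _ ≤ ∑ i ∈ Finset.range (n + 1), K * lam ^ i := Finset.sum_le_sum fun i _ => (hbounds i).2
      _ = K * ((lam ^ (n + 1) - 1) / (lam - 1)) := by
          rw [← Finset.mul_sum, geom_sum_eq hlam'.ne']
      _ ≤ K * (lam ^ (n + 1) / (lam - 1)) := by
          gcongr
          linarith
      _ = K * (lam / (lam - 1)) * lam ^ n := by rw [pow_succ]; ring
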